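/- For every integer j ≥ 0, the standard (1,1) diagram with four-tuple (p,q,r,s) = (7+4j, 3, 4j, 2) is strongly almost coherent. (The diagrammatic content of Corollary 1.5 of the paper, defining the family of knots K_j.) -/

import Mathlib

/-!
Common combinatorial framework for standard (1,1) diagrams in Rasmussen standard
form, their lifts to the universal cover of the torus, and the combinatorial knot
Floer chain complexes they define.
-/

namespace OneOneKnot

open scoped Classical

noncomputable section

/-- A state in the traversal of the lifts of the `β` curve of a standard (1,1) diagram
to the universal cover `ℝ²` of the torus.  `pos` is the position coordinate of an
intersection point of `β` with a lift of `α`; `up` records whether `β` crosses that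
lift of `α` upwards (with respect to the reference orientation of `β`); `top` records
whether `pos` is measured as a top-edge or a bottom-edge coordinate of the
corresponding fundamental rectangle; `ht` is the index of the lift of `α` (the line
`y = ht`). -/
structure CState where
  pos : ℤ
  up : Bool
  top : Bool
  ht : ℤ

/-- The data of a standard (1,1) diagram in Rasmussen standard form, encoded by a
four-tuple `(p, q, r, s)` with `q, r ≥ 0`, `2q + r ≤ p` and `0 ≤ s < p`. -/
structure StdDiagram where
  p : ℕ
  q : ℕ
  r : ℕ
  s : ℕ
  hp : 0 < p
  h2qr : 2 * q + r ≤ p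
  hs : s < p

namespace StdDiagram

variable (D : StdDiagram)

def pz : ℤ := D.p
def qz : ℤ := D.q
def rz : ℤ := D.r
def sz : ℤ := D.s

/-- One step forward along (a lift of) `β`, with respect to a reference orientation of
`β`.  This is Algorithm 1 of the paper: rainbow arcs occupy top-edge positions
`r, …, r + 2q - 1` and bottom-edge positions `0, …, 2q - 1` (mod `p`), the `i`-th
point of the top edge is identified with the `(i+s)`-th point of the bottom edge, and
`ht` records the line `y = ht` of the universal cover on which the point lies. -/
def step (σ : CState) : CState :=
  let m := σ.pos % D.pz
  if σ.top then
    if σ.up then ⟨σ.pos + D.sz, σ.up, false, σ.ht⟩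
    else if m ≤ D.rz - 1 then ⟨σ.pos + 2 * D.qz, σ.up, false, σ.ht - 1⟩
    else if m ≤ D.rz + 2 * D.qz - 1 then
      ⟨2 * D.rz + 2 * D.qz - 1 - 2 * m + σ.pos, true, true, σ.ht⟩
    else ⟨σ.pos, σ.up, false, σ.ht - 1⟩
  else
    if σ.up = false then ⟨σ.pos - D.sz, σ.up, true, σ.ht⟩
    else if m ≤ 2 * D.qz - 1 then ⟨2 * D.qz - 1 - 2 * m + σ.pos, false, false, σ.ht⟩
    else if m ≤ D.rz + 2 * D.qz - 1 then ⟨σ.pos - 2 * D.qz, σ.up, true, σ.ht + 1⟩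
    else ⟨σ.pos, σ.up, true, σ.ht + 1⟩

/-- One step backward along `β` (the inverse of `step`). -/
def stepB (σ : CState) : CState :=
  let m := σ.pos % D.pz
  if σ.top then
    if σ.up then
      if D.rz ≤ m ∧ m ≤ D.rz + 2 * D.qz - 1 then
        ⟨2 * D.rz + 2 * D.qz - 1 - 2 * m + σ.pos, false, true, σ.ht⟩
      else if m ≤ D.rz - 1 then ⟨σ.pos + 2 * D.qz, true, false, σ.ht - 1⟩
      else ⟨σ.pos, true, false, σ.ht - 1⟩
    else ⟨σ.pos + D.sz, false, false, σ.ht⟩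
  else
    if σ.up then ⟨σ.pos - D.sz, true, true, σ.ht⟩
    else
      if m ≤ 2 * D.qz - 1 then ⟨2 * D.qz - 1 - 2 * m + σ.pos, true, false, σ.ht⟩
      else if m ≤ 2 * D.qz + D.rz - 1 then ⟨σ.pos - 2 * D.qz, false, true, σ.ht + 1⟩
      else ⟨σ.pos, false, true, σ.ht + 1⟩

/-- Reference starting state: the intersection point with top-edge coordinate `0`
on the line `y = 0`. -/
def start0 : CState := ⟨0, false, true, 0⟩

/-- `β` is a single closed curve: its traversal passes through all `p`
intersection points with `α`. -/
def Connected : Prop :=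
  ∀ k : ℕ, k < D.p → ∃ n : ℕ,
    ((D.step)^[n] start0).top = true ∧ ((D.step)^[n] start0).pos % D.pz = (k : ℤ)

/-- `β` crosses the intersection point with top-edge coordinate `≡ k (mod p)`
upwards, with respect to the reference orientation of `β`. -/
def UpAt (k : ℤ) : Prop :=
  ∃ n : ℕ, ((D.step)^[n] start0).top = true ∧
    ((D.step)^[n] start0).pos % D.pz = k % D.pz ∧ ((D.step)^[n] start0).up = true

/-- The algebraic intersection number `α · β` computed with the reference
orientation of `β` (and `α` oriented from left to right). -/
def algInt : ℤ := ∑ k ∈ Finset.range D.p, (if D.UpAt (k : ℤ) then (1 : ℤ) else -1)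

/-- One step forward along `β` for the orientation of `β` normalised so that
`α · β > 0`. -/
def fstep (σ : CState) : CState := if 0 < D.algInt then D.step σ else D.stepB σ

/-- With the normalised orientation, `β` crosses `α` upwards at the given state. -/
def TrueUp (σ : CState) : Prop := (0 < D.algInt ↔ σ.up = true)

/-- With the normalised orientation, `β` crosses the intersection point with
top-edge coordinate `≡ k (mod p)` upwards. -/
def TrueUpPt (k : ℤ) : Prop := (0 < D.algInt ↔ D.UpAt k)

/-- The canonical state sitting at the intersection point `k` on the line `y = 0`
(of the chosen lift `α̃` of `α`). -/
def spt (k : ℕ) : CState := ⟨(k : ℤ), if D.UpAt (k : ℤ) then true else false, true, 0⟩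

/-- The state is an intersection point of `β̃` with the line `y = 0`
(recorded with its canonical top-edge coordinate). -/
def IsCross0 (σ : CState) : Prop := σ.top = true ∧ σ.ht = 0

/-- The portion of `β̃` after `σ` returns to the line `y = 0`; that is, `σ` is the
starting point of a compact arc cut off by `α̃` rather than of a ray. -/
def Returns0 (σ : CState) : Prop := ∃ n : ℕ, 1 ≤ n ∧ IsCross0 ((D.fstep)^[n] σ)

/-- Number of `fstep`-moves until the next intersection with the line `y = 0`. -/
def ret0Steps (σ : CState) : ℕ := sInf {n : ℕ | 1 ≤ n ∧ IsCross0 ((D.fstep)^[n] σ)}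

/-- The next intersection point of `β̃` with the line `y = 0` after `σ`. -/
def nxt0 (σ : CState) : CState := (D.fstep)^[D.ret0Steps σ] σ

/-- The label (downstairs intersection point) of a state. -/
def lab (σ : CState) : ℤ := σ.pos % D.pz

/-- The compact arc of `β̃` starting at the intersection point `k` of the line
`y = 0` is oriented rightward (for the normalised orientation of `β`). -/
def ArcRight (k : ℕ) : Prop := (k : ℤ) < (D.nxt0 (D.spt k)).pos

/-- Starting points of the compact arcs in the upper half-plane cut off by `α̃`
from the union of the lifts `β̃ₛ`. -/
def UpperStarts : Finset ℕ :=
  (Finset.range D.p).filter fun k => D.Returns0 (D.spt k) ∧ D.TrueUp (D.spt k)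

/-- Starting points of the compact arcs in the lower half-plane. -/
def LowerStarts : Finset ℕ :=
  (Finset.range D.p).filter fun k => D.Returns0 (D.spt k) ∧ ¬ D.TrueUp (D.spt k)

/-- The number of compact arcs in the upper half-plane with orientation `b`
(`true` = rightward, `false` = leftward). -/
def uCnt (b : Bool) : ℕ := (D.UpperStarts.filter fun k => D.ArcRight k ↔ b = true).card

/-- The number of compact arcs in the lower half-plane with orientation `b`. -/
def lCnt (b : Bool) : ℕ := (D.LowerStarts.filter fun k => D.ArcRight k ↔ b = true).card

/-- Definition 3.2: the standard diagram is *virtually almost coherent* if, for an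
admissible choice of inconsistent direction in each half-plane (the inconsistent
direction must be carried by at most as many arcs as the other direction), the
union of the lifts `β̃ₛ` contains exactly two inconsistent arcs. -/
def VirtuallyAlmostCoherent : Prop :=
  ∃ dU dL : Bool,
    D.uCnt dU ≤ D.uCnt (!dU) ∧ D.lCnt dL ≤ D.lCnt (!dL) ∧ D.uCnt dU + D.lCnt dL = 2

/-- `k` is the starting point of one of the two inconsistent arcs, for the choice
`(dU, dL)` of inconsistent directions in the upper and lower half-planes. -/
def InconsCoverArc (dU dL : Bool) (k : ℕ) : Prop :=
  (k ∈ D.UpperStarts ∧ (D.ArcRight k ↔ dU = true)) ∨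
  (k ∈ D.LowerStarts ∧ (D.ArcRight k ↔ dL = true))

/-! ### Rainbow arcs of the diagram downstairs -/

/-- The rainbow arcs of the standard diagram: `(true, i)` with `r ≤ i < r + q` is the
rainbow arc attached to the top edge with feet `i` and `2r + 2q - 1 - i`; `(false, j)`
with `j < q` is the rainbow arc attached to the bottom edge with feet `j` and
`2q - 1 - j`.  The two families are the rainbow arcs around the two basepoints. -/
def rainbowArcs : Finset (Bool × ℕ) :=
  ((Finset.Ico D.r (D.r + D.q)).image fun i => ((true : Bool), i)) ∪
    ((Finset.range D.q).image fun j => ((false : Bool), j))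

/-- The two endpoints of a rainbow arc, as intersection points of `α ∩ β` recorded
by their top-edge coordinates in `ZMod p`. -/
def rEnds (a : Bool × ℕ) : Finset (ZMod D.p) :=
  if a.1 then
    {((a.2 : ℤ) : ZMod D.p), ((2 * D.rz + 2 * D.qz - 1 - (a.2 : ℤ) : ℤ) : ZMod D.p)}
  else
    {(((a.2 : ℤ) - D.sz : ℤ) : ZMod D.p), ((2 * D.qz - 1 - (a.2 : ℤ) - D.sz : ℤ) : ZMod D.p)}

/-- A rainbow arc is oriented rightward (with the normalised orientation of `β`):
a top-edge rainbow arc is traversed starting from the endpoint where `β` crosses `α`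
downwards, a bottom-edge one from the endpoint where `β` crosses `α` upwards. -/
def rOrientRight (a : Bool × ℕ) : Prop :=
  if a.1 then ¬ D.TrueUpPt (a.2 : ℤ) else D.TrueUpPt ((a.2 : ℤ) - D.sz)

/-- The number of rainbow arcs in the family `f` (`true` = attached to the top edge)
with orientation `b` (`true` = rightward). -/
def famCnt (f : Bool) (b : Bool) : ℕ :=
  (D.rainbowArcs.filter fun a => a.1 = f ∧ (D.rOrientRight a ↔ b = true)).card

/-- `a` is an inconsistent rainbow arc for the choice `(dT, dB)` of inconsistent
directions for the two families. -/
def InconsArc (dT dB : Bool) (a : Bool × ℕ) : Prop :=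
  a ∈ D.rainbowArcs ∧ (D.rOrientRight a ↔ (if a.1 then dT else dB) = true)

/-- Two rainbow arcs share a common endpoint. -/
def ShareEnd (a b : Bool × ℕ) : Prop := ((D.rEnds a) ∩ (D.rEnds b)).Nonempty

/-- Two rainbow arcs are connected to each other by two other rainbow arcs. -/
def ConnectedByTwo (a1 a2 : Bool × ℕ) : Prop :=
  ∃ b1 b2 : Bool × ℕ, b1 ∈ D.rainbowArcs ∧ b2 ∈ D.rainbowArcs ∧
    b1 ≠ a1 ∧ b1 ≠ a2 ∧ b2 ≠ a1 ∧ b2 ≠ a2 ∧ b1 ≠ b2 ∧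
    D.ShareEnd a1 b1 ∧ D.ShareEnd b1 b2 ∧ D.ShareEnd b2 a2

/-- Definition 1.2: the standard diagram is *strongly almost coherent* if, for an
admissible choice of inconsistent directions, there are exactly two inconsistent
rainbow arcs, and either they share a common endpoint, or they are connected to each
other by two other rainbow arcs. -/
def StronglyAlmostCoherent : Prop :=
  ∃ dT dB : Bool,
    D.famCnt true dT ≤ D.famCnt true (!dT) ∧ D.famCnt false dB ≤ D.famCnt false (!dB) ∧
    ∃ a1 a2 : Bool × ℕ, a1 ≠ a2 ∧ (∀ a, D.InconsArc dT dB a ↔ (a = a1 ∨ a = a2)) ∧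
      (D.ShareEnd a1 a2 ∨ D.ConnectedByTwo a1 a2)

/-! ### Spin^c classes of intersection points -/

/-- The point `l` is reached from the point `k` by travelling forward along the lift
`β̃` through (the lift at height `0` of) `k`, meeting it on the line `y = 0`. -/
def Reach (k l : ℕ) : Prop :=
  ∃ n : ℕ, IsCross0 ((D.fstep)^[n] (D.spt k)) ∧
    ((D.fstep)^[n] (D.spt k)).pos % D.pz = (l : ℤ)

/-- Two intersection points are in the same class (i.e. they induce the same
spin^c structure): some lift of `β` meeting the line `y = 0` passes through lifts
of both of them on that line. -/
def SameClass (k l : ℕ) : Prop := D.Reach k l ∨ D.Reach l k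

/-! ### The sequence of intersection points along a lift -/

/-- The `m`-th intersection point of `β̃ₛ` with the line `y = 0` after the point `c`. -/
def seqSt (c m : ℕ) : CState := (D.nxt0)^[m] (D.spt c)

/-- Its label downstairs. -/
def labAt (c m : ℕ) : ℤ := D.lab (D.seqSt c m)

/-- Its position coordinate on the line `y = 0`. -/
def posAt (c m : ℕ) : ℤ := (D.seqSt c m).pos

/-- The differential component carried by the compact arc starting at `k` points
from the starting point of the arc towards its end point.  (For an arc in the upper
half-plane the source of the arrow is the right endpoint, for an arc in the lower
half-plane it is the left endpoint.) -/
def srcIsStart (k : ℕ) : Prop :=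
  ¬ (D.TrueUp (D.spt k) ↔ (k : ℤ) < (D.nxt0 (D.spt k)).pos)

/-- The label of the source of the differential component carried by the arc
starting at `k`. -/
def srcLab (k : ℕ) : ℤ :=
  if D.srcIsStart k then (k : ℤ) % D.pz else (D.nxt0 (D.spt k)).pos % D.pz

/-- The label of the target of the differential component carried by the arc
starting at `k`. -/
def tgtLab (k : ℕ) : ℤ :=
  if D.srcIsStart k then (D.nxt0 (D.spt k)).pos % D.pz else (k : ℤ) % D.pz

/-- The number of bigons (compact arcs) inducing a differential component from `x`
to `y`. -/
def arrowCnt (x y : ℕ) : ℕ :=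
  ((Finset.range D.p).filter fun k =>
    D.Returns0 (D.spt k) ∧ D.srcLab k = (x : ℤ) ∧ D.tgtLab k = (y : ℤ)).card


/-! ### Counting basepoints inside the bigon cut off by a compact arc -/

/-- Doubled plane `x`-coordinate of a state in the (sheared) universal cover. -/
def x2 (σ : CState) : ℤ := 2 * σ.pos - 2 * D.sz * (if σ.top then σ.ht - 1 else σ.ht)

/-- The number of crossings of the upward vertical ray emanating from the basepoint
slot in row `ρ` with doubled `x`-coordinate `X0` (a `w`-slot if `isZ = false`, sitting
just above the line `y = ρ`; a `z`-slot if `isZ = true`, sitting just below the line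
`y = ρ + 1`) with the piece of `β̃` between the state `σ` and the next state. -/
def rayCross (σ : CState) (X0 ρ : ℤ) (isZ : Bool) : ℕ :=
  let σ' := D.fstep σ
  let lo := min (D.x2 σ) (D.x2 σ')
  let hi := max (D.x2 σ) (D.x2 σ')
  if σ.ht ≠ σ'.ht then
    -- a strand crossing the row between the lines `y = min ht` and `y = min ht + 1`
    (if (ρ < min σ.ht σ'.ht ∨ (ρ = min σ.ht σ'.ht ∧ isZ = false)) ∧ lo < X0 ∧ X0 < hi
      then 1 else 0)
  else if σ.top = σ'.top then
    if σ.top then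
      -- a rainbow arch hanging below the line `y = σ.ht`
      (if (if isZ then ρ ≤ σ.ht - 2 else ρ ≤ σ.ht - 1) ∧ lo < X0 ∧ X0 < hi then 1 else 0)
    else
      -- a rainbow arch sitting above the line `y = σ.ht`
      (if (if isZ then ρ ≤ σ.ht - 1 else ρ ≤ σ.ht) ∧ lo < X0 ∧ X0 < hi then 1 else 0)
  else 0

/-- Doubled plane `x`-coordinate of the basepoint slot of row `ρ`, horizontal
translate `m`: the `w`-basepoint is between bottom-edge coordinates `q - 1` and `q`,
the `z`-basepoint between top-edge coordinates `r + q - 1` and `r + q`. -/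
def slotX2 (ρ m : ℤ) (isZ : Bool) : ℤ :=
  (if isZ then 2 * (D.rz + D.qz) - 1 else 2 * D.qz - 1) - 2 * ρ * D.sz + 2 * m * D.pz

/-- The states traversed by the compact arc starting at the intersection point `k`. -/
def arcState (k i : ℕ) : CState := (D.fstep)^[i] (D.spt k)

/-- Number of crossings of the upward vertical ray from a slot with the chord of the
bigon (the segment of the line `y = 0` joining the endpoints of the arc). -/
def chordCross (k : ℕ) (X0 ρ : ℤ) : ℕ :=
  if ρ ≤ -1 ∧ min (D.x2 (D.spt k)) (D.x2 (D.nxt0 (D.spt k))) < X0 ∧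
      X0 < max (D.x2 (D.spt k)) (D.x2 (D.nxt0 (D.spt k))) then 1 else 0

/-- A basepoint slot lies inside the (embedded) bigon cobounded by the compact arc
starting at `k` and the line `y = 0`: the upward vertical ray from the slot meets the
boundary of the bigon an odd number of times. -/
def SlotInBigon (k : ℕ) (ρ m : ℤ) (isZ : Bool) : Prop :=
  ¬ (2 ∣ ((D.chordCross k (D.slotX2 ρ m isZ) ρ : ℤ) +
      ∑ i ∈ Finset.range (D.ret0Steps (D.spt k)),
        (D.rayCross (D.arcState k i) (D.slotX2 ρ m isZ) ρ isZ : ℤ)))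

/-- A bound for the rows met by the arc starting at `k`. -/
def hBound (k : ℕ) : ℕ :=
  ((Finset.range (D.ret0Steps (D.spt k) + 1)).sup fun i => (D.arcState k i).ht.natAbs) + 2

/-- A bound for the horizontal translates of slots met by the arc starting at `k`. -/
def mBound (k : ℕ) : ℕ :=
  ((Finset.range (D.ret0Steps (D.spt k) + 1)).sup fun i => (D.arcState k i).pos.natAbs)
    + (D.hBound k + 2) * (D.s + 1) + D.p + D.q + D.r + 4

/-- The number of lifts of the `w`-basepoint (`isZ = false`), respectively of the
`z`-basepoint (`isZ = true`), inside the bigon cobounded by the compact arc starting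
at `k` and the line `y = 0`. -/
def arcBase (k : ℕ) (isZ : Bool) : ℕ :=
  (((Finset.Icc (-(D.hBound k : ℤ)) (D.hBound k)) ×ˢ
      (Finset.Icc (-(D.mBound k : ℤ)) (D.mBound k))).filter
    fun ρm => D.SlotInBigon k ρm.1 ρm.2 isZ).card

/-- The arc starting at `k` stays within the two rows adjacent to the line `y = 0`
(equivalently, it has height `< 1`). -/
def ArcWithinRow (k : ℕ) : Prop :=
  ∀ n : ℕ, n ≤ D.ret0Steps (D.spt k) → (D.arcState k n).ht = 0

/-- The arc starting at `k` is a lift of a single rainbow arc of the diagram. -/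
def ArcIsRainbowLift (k : ℕ) : Prop := D.ret0Steps (D.spt k) = 3

/-! ### Gradings and filtrations of the knot Floer complex -/

/-- The relative Maslov grading changes by `±1` along each arc, dropping (by `1`)
from the source of its differential component to the target. -/
def grStep (k : ℕ) : ℤ := if D.srcIsStart k then -1 else 1

/-- The relative `i`-filtration drops, from the source of the differential component
carried by an arc to the target, by the number of `w`-basepoints in its bigon. -/
def faStep (k : ℕ) : ℤ := (if D.srcIsStart k then -1 else 1) * (D.arcBase k false : ℤ)

/-- The relative `j`-filtration drops by the number of `z`-basepoints in the bigon. -/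
def fbStep (k : ℕ) : ℤ := (if D.srcIsStart k then -1 else 1) * (D.arcBase k true : ℤ)

/-- The sum of the per-arc increments of a relative grading along the first `m` arcs
of the lift `β̃` starting at the point `c`. -/
def pathSum (f : ℕ → ℤ) (c m : ℕ) : ℤ := ∑ i ∈ Finset.range m, f (D.labAt c i).toNat

/-- `a` occurs in the forward sequence of intersection points of `β̃` with the line
`y = 0` starting at `c`. -/
def ReachIn (c a : ℕ) : Prop := ∃ m : ℕ, D.labAt c m = (a : ℤ)

/-- The value at `a` of the relative grading with per-arc increments `f`, normalised
to vanish at the base point `c` of the class. -/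
def relOf (f : ℕ → ℤ) (c a : ℕ) : ℤ :=
  if h : D.ReachIn c a then D.pathSum f c (Nat.find h)
  else if h' : D.ReachIn a c then - D.pathSum f a (Nat.find h') else 0

/-- The Maslov grading of the generator `a` of the class of `c` (normalised at `c`). -/
def grOf (c a : ℕ) : ℤ := D.relOf D.grStep c a

/-- The `i`-filtration of the generator `a` of the class of `c`. -/
def faOf (c a : ℕ) : ℤ := D.relOf D.faStep c a

/-- The `j`-filtration of the generator `a` of the class of `c`. -/
def fbOf (c a : ℕ) : ℤ := D.relOf D.fbStep c a

/-- The number of generators of the class of `c` in Maslov grading `g`. -/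
def grCountClass (c : ℕ) (g : ℤ) : ℕ :=
  ((Finset.range D.p).filter fun a => D.SameClass a c ∧ D.grOf c a = g).card

/-! ### Turning points -/

/-- The differential component of the arc from the `i`-th to the `(i+1)`-st point of
the sequence along `β̃ₛ` starting at `c` points forward. -/
def srcIsStartAt (c i : ℕ) : Prop := D.srcIsStart (D.labAt c i).toNat

/-- The cumulative relative Maslov grading of the `m`-th point of the sequence along
`β̃ₛ` starting at `c`. -/
def grPartial (c m : ℕ) : ℤ :=
  ∑ i ∈ Finset.range m, (if D.srcIsStartAt c i then (-1 : ℤ) else 1)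

/-- The `m`-th point of the sequence along `β̃ₛ` starting at `c` is a *turning point*:
its position on the line `y = 0` is either greater or smaller than the positions of
both its predecessor and its successor. -/
def TurningAt (c m : ℕ) : Prop :=
  1 ≤ m ∧ ((D.posAt c (m - 1) < D.posAt c m ∧ D.posAt c (m + 1) < D.posAt c m) ∨
    (D.posAt c m < D.posAt c (m - 1) ∧ D.posAt c m < D.posAt c (m + 1)))

/-- A *positive* turning point: its predecessor appears in its differential. -/
def PosTurningAt (c m : ℕ) : Prop := D.TurningAt c m ∧ ¬ D.srcIsStartAt c (m - 1)

/-- A *negative* turning point: it appears in the differential of its predecessor. -/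
def NegTurningAt (c m : ℕ) : Prop := D.TurningAt c m ∧ D.srcIsStartAt c (m - 1)

end StdDiagram

/-! ### Bifiltered complexes over 𝔽₂ -/

/-- A based, bifiltered, Maslov-graded complex over `𝔽₂ = ZMod 2`:  `d x y` is the
coefficient of the basis element `y` in the differential of the basis element `x`,
`gr` is the Maslov grading and `(fa, fb)` the `(i, j)`-bifiltration levels of the
basis elements. -/
structure BFC where
  ι : Type
  fin : Fintype ι
  dec : DecidableEq ι
  d : ι → ι → ZMod 2
  gr : ι → ℤ
  fa : ι → ℤ
  fb : ι → ℤ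

attribute [instance] BFC.fin BFC.dec

namespace BFC

/-- The dual of a bifiltered complex. -/
def dual (C : BFC) : BFC :=
  ⟨C.ι, C.fin, C.dec, fun u v => C.d v u, fun u => - C.gr u, fun u => - C.fa u,
    fun u => - C.fb u⟩

/-- The subcomplex (of a direct summand) spanned by the basis elements selected
by `S`. -/
def sub (C : BFC) (S : C.ι → Bool) : BFC where
  ι := {u : C.ι // S u = true}
  fin := Subtype.fintype _
  dec := Classical.decEq _
  d u v := C.d u.1 v.1
  gr u := C.gr u.1
  fa u := C.fa u.1
  fb u := C.fb u.1

/-- The number of basis elements in Maslov grading `g`. -/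
def grCount (C : BFC) (g : ℤ) : ℕ := (Finset.univ.filter fun u : C.ι => C.gr u = g).card

end BFC

/-- Definition 2.1: a positive staircase with `2N + 1` generators
`y₁, x₁, y₂, x₂, …, y_{N+1}` (even positions along the zigzag are the `y`'s, odd
positions the `x`'s), with `∂ xₗ = yₗ + y_{ℓ+1}`, `∂ yₗ = 0`, where consecutive
generators differ in only one of the two filtration coordinates, alternately. -/
def IsPosStaircaseOf (N : ℕ) (C : BFC) : Prop :=
  ∃ (e : Fin (2 * N + 1) ≃ C.ι) (f : Bool),
    (∀ k l : Fin (2 * N + 1), C.d (e k) (e l) =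
      if k.1 % 2 = 1 ∧ (k.1 = l.1 + 1 ∨ l.1 = k.1 + 1) then 1 else 0) ∧
    (∀ k l : Fin (2 * N + 1), l.1 = k.1 + 1 →
      (C.gr (e l) = C.gr (e k) + (if k.1 % 2 = 0 then 1 else -1)) ∧
      (if decide (k.1 % 2 = 0) = f then
        C.fb (e k) = C.fb (e l) ∧
          (if k.1 % 2 = 0 then C.fa (e k) < C.fa (e l) else C.fa (e l) < C.fa (e k))
      else
        C.fa (e k) = C.fa (e l) ∧
          (if k.1 % 2 = 0 then C.fb (e k) < C.fb (e l) else C.fb (e l) < C.fb (e k))))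

/-- A positive staircase (of any length). -/
def IsPosStaircase (C : BFC) : Prop := ∃ N : ℕ, IsPosStaircaseOf N C

/-- A negative staircase is the dual of a positive staircase. -/
def IsNegStaircase (C : BFC) : Prop := IsPosStaircase C.dual

/-- A staircase: a positive or a negative staircase. -/
def IsStaircase (C : BFC) : Prop := IsPosStaircase C ∨ IsNegStaircase C

/-- A staircase of given sign (`true` = positive). -/
def IsSignedStaircase (b : Bool) (C : BFC) : Prop :=
  if b then IsPosStaircase C else IsNegStaircase C

/-- A box of length 1: generators `a, b, c, d` at bifiltration levels
`(0,0), (0,1), (1,0), (1,1)` (up to an overall shift), with `∂d = b + c`,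
`∂b = ∂c = a`, `∂a = 0`. -/
def IsBox (C : BFC) : Prop :=
  ∃ (e : Fin 4 ≃ C.ι) (a0 b0 g0 : ℤ),
    C.fa (e 0) = a0 ∧ C.fb (e 0) = b0 ∧ C.gr (e 0) = g0 ∧
    C.fa (e 1) = a0 ∧ C.fb (e 1) = b0 + 1 ∧ C.gr (e 1) = g0 + 1 ∧
    C.fa (e 2) = a0 + 1 ∧ C.fb (e 2) = b0 ∧ C.gr (e 2) = g0 + 1 ∧
    C.fa (e 3) = a0 + 1 ∧ C.fb (e 3) = b0 + 1 ∧ C.gr (e 3) = g0 + 2 ∧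
    (∀ k l : Fin 4, C.d (e k) (e l) =
      if (k = 3 ∧ (l = 1 ∨ l = 2)) ∨ ((k = 1 ∨ k = 2) ∧ l = 0) then 1 else 0)

/-- `C` is the direct sum of a complex satisfying `P1` and one satisfying `P2`. -/
def IsDirectSumOf (C : BFC) (P1 P2 : BFC → Prop) : Prop :=
  ∃ S : C.ι → Bool, (∀ u v : C.ι, S u ≠ S v → C.d u v = 0) ∧
    P1 (C.sub S) ∧ P2 (C.sub fun u => ! S u)

/-- Definition 2.3 (a): a positive almost staircase of type (a), with generators
`x₁, …, x_{2k}`, `y₁, …, y_{2k+1}`, `y'_{k+1}` and `z`. -/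
def IsPosAlmostStairA (C : BFC) : Prop :=
  ∃ k : ℕ, 1 ≤ k ∧ ∃ (X Y : ℕ → C.ι) (y' z : C.ι) (a0 b0 : ℤ),
    Fintype.card C.ι = 4 * k + 3 ∧
    (∀ u : C.ι, u = y' ∨ u = z ∨ (∃ ℓ, 1 ≤ ℓ ∧ ℓ ≤ 2 * k ∧ u = X ℓ) ∨
      (∃ ℓ, 1 ≤ ℓ ∧ ℓ ≤ 2 * k + 1 ∧ u = Y ℓ)) ∧
    (∀ u v : C.ι, C.d u v ≠ 0 → C.gr u = C.gr v + 1) ∧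
    C.fa (Y (k + 1)) = a0 ∧ C.fb (Y (k + 1)) = b0 + 1 ∧
    C.fa y' = a0 + 1 ∧ C.fb y' = b0 ∧ C.fa z = a0 ∧ C.fb z = b0 ∧
    (∀ ℓ, 1 ≤ ℓ → ℓ ≤ 2 * k → C.fb (X ℓ) = C.fb (Y ℓ) ∧ C.fa (Y ℓ) < C.fa (X ℓ)) ∧
    (∀ ℓ, 1 ≤ ℓ → ℓ ≤ 2 * k → ℓ ≠ k →
      C.fa (X ℓ) = C.fa (Y (ℓ + 1)) ∧ C.fb (Y (ℓ + 1)) < C.fb (X ℓ)) ∧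
    (C.fa (X k) = C.fa y' ∧ C.fb y' < C.fb (X k)) ∧
    (∀ ℓ, 1 ≤ ℓ → ℓ ≤ 2 * k → ℓ ≠ k → ℓ ≠ k + 1 →
      ∀ v, C.d (X ℓ) v = if v = Y ℓ ∨ v = Y (ℓ + 1) then 1 else 0) ∧
    (∀ v, C.d (X k) v = if v = Y k ∨ v = Y (k + 1) ∨ v = y' then 1 else 0) ∧
    (∀ v, C.d (X (k + 1)) v = if v = Y (k + 1) ∨ v = Y (k + 2) ∨ v = y' then 1 else 0) ∧
    (∀ v, C.d (Y (k + 1)) v = if v = z then 1 else 0) ∧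
    (∀ v, C.d y' v = if v = z then 1 else 0) ∧
    (∀ ℓ, 1 ≤ ℓ → ℓ ≤ 2 * k + 1 → ℓ ≠ k + 1 → ∀ v, C.d (Y ℓ) v = 0) ∧
    (∀ v, C.d z v = 0)

/-- Definition 2.3 (b): a positive almost staircase of type (b), with generators
`x₁, …, x_{2k+1}`, `x'_{k+1}`, `y₁, …, y_{2k+2}` and `z`. -/
def IsPosAlmostStairB (C : BFC) : Prop :=
  ∃ k : ℕ, 1 ≤ k ∧ ∃ (X Y : ℕ → C.ι) (x' z : C.ι) (a0 b0 : ℤ),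
    Fintype.card C.ι = 4 * k + 5 ∧
    (∀ u : C.ι, u = x' ∨ u = z ∨ (∃ ℓ, 1 ≤ ℓ ∧ ℓ ≤ 2 * k + 1 ∧ u = X ℓ) ∨
      (∃ ℓ, 1 ≤ ℓ ∧ ℓ ≤ 2 * k + 2 ∧ u = Y ℓ)) ∧
    (∀ u v : C.ι, C.d u v ≠ 0 → C.gr u = C.gr v + 1) ∧
    C.fa (X (k + 1)) = a0 ∧ C.fb (X (k + 1)) = b0 - 1 ∧
    C.fa x' = a0 - 1 ∧ C.fb x' = b0 ∧ C.fa z = a0 ∧ C.fb z = b0 ∧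
    (∀ ℓ, 1 ≤ ℓ → ℓ ≤ 2 * k + 1 → C.fb (X ℓ) = C.fb (Y ℓ) ∧ C.fa (Y ℓ) < C.fa (X ℓ)) ∧
    (∀ ℓ, 1 ≤ ℓ → ℓ ≤ 2 * k + 1 → ℓ ≠ k + 1 →
      C.fa (X ℓ) = C.fa (Y (ℓ + 1)) ∧ C.fb (Y (ℓ + 1)) < C.fb (X ℓ)) ∧
    (C.fa x' = C.fa (Y (k + 2)) ∧ C.fb (Y (k + 2)) < C.fb x') ∧
    (∀ ℓ, 1 ≤ ℓ → ℓ ≤ 2 * k + 1 → ℓ ≠ k + 1 →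
      ∀ v, C.d (X ℓ) v = if v = Y ℓ ∨ v = Y (ℓ + 1) then 1 else 0) ∧
    (∀ v, C.d z v = if v = X (k + 1) ∨ v = x' then 1 else 0) ∧
    (∀ v, C.d (X (k + 1)) v = if v = Y (k + 1) ∨ v = Y (k + 2) then 1 else 0) ∧
    (∀ v, C.d x' v = if v = Y (k + 1) ∨ v = Y (k + 2) then 1 else 0) ∧
    (∀ ℓ, 1 ≤ ℓ → ℓ ≤ 2 * k + 2 → ∀ v, C.d (Y ℓ) v = 0)

/-- A positive almost staircase. -/
def IsPosAlmostStaircase (C : BFC) : Prop := IsPosAlmostStairA C ∨ IsPosAlmostStairB C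

/-- A negative almost staircase is the dual of a positive almost staircase. -/
def IsNegAlmostStaircase (C : BFC) : Prop := IsPosAlmostStaircase C.dual

/-- `C'` is obtained from `C` by a filtered change of basis: each basis element is
replaced by itself plus a sum of basis elements of the same Maslov grading and of
bifiltration level not higher in either coordinate. -/
def FilteredBasisChange (C C' : BFC) : Prop :=
  ∃ e : C'.ι ≃ C.ι,
    (∀ u, C'.gr u = C.gr (e u)) ∧ (∀ u, C'.fa u = C.fa (e u)) ∧
    (∀ u, C'.fb u = C.fb (e u)) ∧
    ∃ P Q : Matrix C.ι C.ι (ZMod 2),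
      P * Q = 1 ∧ Q * P = 1 ∧ (∀ u, P u u = 1) ∧
      (∀ u v, u ≠ v → P u v ≠ 0 → C.gr u = C.gr v ∧ C.fa v ≤ C.fa u ∧ C.fb v ≤ C.fb u) ∧
      (∀ u v, C'.d u v = (P * Matrix.of C.d * Q) (e u) (e v))

/-- `C` satisfies `P` after some filtered change of basis. -/
def AfterFCB (C : BFC) (P : BFC → Prop) : Prop := ∃ C', FilteredBasisChange C C' ∧ P C'

/-- The knot Floer chain complex `CFK(H, s)` of the standard diagram, in the spin^c
class of the intersection point `c`: it is generated by the intersection points of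
the class of `c`; the coefficient `⟨∂x, y⟩` counts (mod 2) the embedded bigons in
the universal cover cobounded by `α̃` and `β̃ₛ` from a lift of `x` to a lift of `y`;
the relative Maslov grading drops by `1` along each differential, and the relative
`(i, j)`-bifiltration drops according to the number of lifts of the basepoints `w`
and `z` covered by each bigon. -/
def CFK (D : StdDiagram) (c : ℕ) : BFC where
  ι := {a : Fin D.p // D.SameClass a c}
  fin := Subtype.fintype _
  dec := Classical.decEq _
  d x y := (D.arrowCnt x.1 y.1 : ZMod 2)
  gr x := D.grOf c x.1
  fa x := D.faOf c x.1
  fb x := D.fbOf c x.1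


/-- The standard (1,1) diagram of the knot `K_j`, with four-tuple
`(p, q, r, s) = (7 + 4j, 3, 4j, 2)`. -/
def Kdiagram (j : ℕ) : StdDiagram :=
  ⟨7 + 4 * j, 3, 4 * j, 2, by omega, by omega, by omega⟩

namespace Kdiagram

/-- The residue of the position of `σ` modulo `p = 4j + 7`, together with the edge and the
direction recorded by `σ`, is `(m, top, up)`. -/
def HasResidue (j : ℕ) (σ : CState) (top up : Bool) (m : ℤ) : Prop :=
  σ.top = top ∧ σ.up = up ∧ σ.pos % (Kdiagram j).pz = m

variable {j : ℕ} {σ : CState} {m : ℤ}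

theorem pz_eq : (Kdiagram j).pz = 4 * j + 7 := by
  simp [StdDiagram.pz, Kdiagram]; ring

theorem qz_eq : (Kdiagram j).qz = 3 := by simp [StdDiagram.qz, Kdiagram]

theorem rz_eq : (Kdiagram j).rz = 4 * j := by simp [StdDiagram.rz, Kdiagram]

theorem sz_eq : (Kdiagram j).sz = 2 := by simp [StdDiagram.sz, Kdiagram]

theorem emod_eq_of_shift {p a m m' c : ℤ} (ham : a % p = m) (h0 : 0 ≤ m') (hp : m' < p) {b : ℤ}
    (hb : b - a = m' - m + p * c) : b % p = m' := by
  have h := Int.emod_add_mul_ediv a p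
  have hb' : b = m' + p * (a / p + c) := by rw [mul_add]; linarith
  rw [hb', Int.add_mul_emod_self_left, Int.emod_eq_of_lt h0 hp]

theorem HasResidue.bounds {top up : Bool} (h : HasResidue j σ top up m) :
    0 ≤ m ∧ m < 4 * j + 7 := by
  obtain ⟨-, -, rfl⟩ := h
  rw [pz_eq]
  exact ⟨Int.emod_nonneg _ (by omega), Int.emod_lt_of_pos _ (by omega)⟩

theorem HasResidue.step_top_up (h : HasResidue j σ true true m) (hm : m ≤ 4 * j + 4) :
    HasResidue j ((Kdiagram j).step σ) false true (m + 2) := by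
  have hb := h.bounds
  obtain ⟨ht, hu, hm'⟩ := h
  simp only [HasResidue, StdDiagram.step, ht, hu, hm', qz_eq, rz_eq, sz_eq, if_true, true_and]
  exact emod_eq_of_shift (c := 0) hm' (by omega) (by rw [pz_eq]; omega) (by ring)

theorem HasResidue.step_top_up_wrap (h : HasResidue j σ true true m) (hm : 4 * j + 5 ≤ m) :
    HasResidue j ((Kdiagram j).step σ) false true (m - (4 * j + 5)) := by
  have hb := h.bounds
  obtain ⟨ht, hu, hm'⟩ := h
  simp only [HasResidue, StdDiagram.step, ht, hu, hm', qz_eq, rz_eq, sz_eq, if_true, true_and]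
  exact emod_eq_of_shift (c := 1) hm' (by omega) (by rw [pz_eq]; omega) (by rw [pz_eq]; ring)

theorem HasResidue.step_top_down_strand (h : HasResidue j σ true false m) (hm : m < 4 * j) :
    HasResidue j ((Kdiagram j).step σ) false false (m + 6) := by
  have hb := h.bounds
  obtain ⟨ht, hu, hm'⟩ := h
  have h1 : m ≤ 4 * j - 1 := by omega
  simp only [HasResidue, StdDiagram.step, ht, hu, hm', qz_eq, rz_eq, sz_eq, if_true, true_and,
    Bool.false_eq_true, if_false, h1]
  exact emod_eq_of_shift (c := 0) hm' (by omega) (by rw [pz_eq]; omega) (by ring)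

theorem HasResidue.step_top_down_rainbow (h : HasResidue j σ true false m) (h1 : 4 * j ≤ m)
    (h2 : m ≤ 4 * j + 5) :
    HasResidue j ((Kdiagram j).step σ) true true (8 * j + 5 - m) := by
  have hb := h.bounds
  obtain ⟨ht, hu, hm'⟩ := h
  have h3 : ¬ m ≤ 4 * j - 1 := by omega
  have h4 : m ≤ 4 * j + 2 * 3 - 1 := by omega
  simp only [HasResidue, StdDiagram.step, ht, hu, hm', qz_eq, rz_eq, sz_eq, if_true, true_and,
    Bool.false_eq_true, if_false, h3, h4]
  exact emod_eq_of_shift (c := 0) hm' (by omega) (by rw [pz_eq]; omega) (by ring)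

theorem HasResidue.step_top_down_last (h : HasResidue j σ true false m) (h1 : 4 * j + 6 ≤ m) :
    HasResidue j ((Kdiagram j).step σ) false false m := by
  obtain ⟨ht, hu, hm'⟩ := h
  have h3 : ¬ m ≤ 4 * j - 1 := by omega
  have h4 : ¬ m ≤ 4 * j + 2 * 3 - 1 := by omega
  simp only [HasResidue, StdDiagram.step, ht, hu, hm', qz_eq, rz_eq, if_true,
    Bool.false_eq_true, if_false, h3, h4, and_self]

theorem HasResidue.step_bot_down (h : HasResidue j σ false false m) (hm : 2 ≤ m) :
    HasResidue j ((Kdiagram j).step σ) true false (m - 2) := by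
  have hb := h.bounds
  obtain ⟨ht, hu, hm'⟩ := h
  simp only [HasResidue, StdDiagram.step, ht, hu, hm', qz_eq, rz_eq, sz_eq, if_true, true_and,
    Bool.false_eq_true, if_false]
  exact emod_eq_of_shift (c := 0) hm' (by omega) (by rw [pz_eq]; omega) (by ring)

theorem HasResidue.step_bot_down_wrap (h : HasResidue j σ false false m) (hm : m ≤ 1) :
    HasResidue j ((Kdiagram j).step σ) true false (m + (4 * j + 5)) := by
  have hb := h.bounds
  obtain ⟨ht, hu, hm'⟩ := h
  simp only [HasResidue, StdDiagram.step, ht, hu, hm', qz_eq, rz_eq, sz_eq, if_true, true_and,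
    Bool.false_eq_true, if_false]
  exact emod_eq_of_shift (c := -1) hm' (by omega) (by rw [pz_eq]; omega) (by rw [pz_eq]; ring)

theorem HasResidue.step_bot_up_rainbow (h : HasResidue j σ false true m) (hm : m ≤ 5) :
    HasResidue j ((Kdiagram j).step σ) false false (5 - m) := by
  have hb := h.bounds
  obtain ⟨ht, hu, hm'⟩ := h
  have h1 : m ≤ 2 * 3 - 1 := by omega
  simp only [HasResidue, StdDiagram.step, ht, hu, hm', qz_eq, rz_eq, sz_eq, true_and,
    Bool.false_eq_true, Bool.true_eq_false, if_false, if_true, h1]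
  exact emod_eq_of_shift (c := 0) hm' (by omega) (by rw [pz_eq]; omega) (by ring)

theorem HasResidue.step_bot_up_strand (h : HasResidue j σ false true m) (h1 : 6 ≤ m)
    (h2 : m ≤ 4 * j + 5) :
    HasResidue j ((Kdiagram j).step σ) true true (m - 6) := by
  have hb := h.bounds
  obtain ⟨ht, hu, hm'⟩ := h
  have h3 : ¬ m ≤ 2 * 3 - 1 := by omega
  have h4 : m ≤ 4 * j + 2 * 3 - 1 := by omega
  simp only [HasResidue, StdDiagram.step, ht, hu, hm', qz_eq, rz_eq, sz_eq, true_and,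
    Bool.false_eq_true, Bool.true_eq_false, if_false, if_true, h3, h4]
  exact emod_eq_of_shift (c := 0) hm' (by omega) (by rw [pz_eq]; omega) (by ring)

/-- The directions of `β` at the points of `α ∩ β`: in top-edge coordinates the upward points
are those congruent to `1` or `2` modulo `4` except for the last one, and in bottom-edge
coordinates those congruent to `0` or `3` modulo `4`. -/
def DirectionOK (j : ℕ) (σ : CState) : Prop :=
  ∃ (top up : Bool) (m : ℤ), HasResidue j σ top up m ∧
    (up = true ↔ if top then (m % 4 = 1 ∨ m % 4 = 2) ∧ m ≠ 4 * j + 6 else m % 4 = 0 ∨ m % 4 = 3)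

theorem DirectionOK.step (h : DirectionOK j σ) : DirectionOK j ((Kdiagram j).step σ) := by
  obtain ⟨top, up, m, h, hd⟩ := h
  have hb := h.bounds
  cases top <;> cases up <;> simp at hd
  · rcases le_or_gt 2 m with hm | hm
    · exact ⟨_, _, _, h.step_bot_down hm, by simp; omega⟩
    · exact ⟨_, _, _, h.step_bot_down_wrap (by omega), by simp; omega⟩
  · rcases le_or_gt m 5 with hm | hm
    · exact ⟨_, _, _, h.step_bot_up_rainbow hm, by simp; omega⟩
    · exact ⟨_, _, _, h.step_bot_up_strand hm (by omega), by simp; omega⟩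
  · rcases lt_or_ge m (4 * j) with hm | hm
    · exact ⟨_, _, _, h.step_top_down_strand hm, by simp; omega⟩
    · rcases le_or_gt m (4 * j + 5) with hm' | hm'
      · exact ⟨_, _, _, h.step_top_down_rainbow hm hm', by simp; omega⟩
      · exact ⟨_, _, _, h.step_top_down_last (by omega), by simp; omega⟩
  · rcases le_or_gt m (4 * j + 4) with hm | hm
    · exact ⟨_, _, _, h.step_top_up hm, by simp; omega⟩
    · exact ⟨_, _, _, h.step_top_up_wrap (by omega), by simp; omega⟩

theorem hasResidue_start0 : HasResidue j StdDiagram.start0 true false 0 := by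
  simp [HasResidue, StdDiagram.start0]

theorem directionOK_iterate (n : ℕ) :
    DirectionOK j (((Kdiagram j).step)^[n] StdDiagram.start0) := by
  induction n with
  | zero => exact ⟨_, _, _, hasResidue_start0, by simp⟩
  | succ n ih => rw [Function.iterate_succ_apply']; exact ih.step

theorem emod_pz (h0 : 0 ≤ m) (h1 : m < 4 * j + 7) : m % (Kdiagram j).pz = m := by
  rw [Int.emod_eq_of_lt h0 (by rw [pz_eq]; omega)]

theorem upAt_imp (h0 : 0 ≤ m) (h1 : m < 4 * j + 7) (h : (Kdiagram j).UpAt m) :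
    (m % 4 = 1 ∨ m % 4 = 2) ∧ m ≠ 4 * j + 6 := by
  obtain ⟨n, ht, hm, hu⟩ := h
  rw [emod_pz h0 h1] at hm
  obtain ⟨top, up, m', ⟨ht', hu', hm'⟩, hd⟩ := directionOK_iterate (j := j) n
  obtain rfl : top = true := ht'.symm.trans ht
  obtain rfl : up = true := hu'.symm.trans hu
  obtain rfl : m' = m := hm'.symm.trans hm
  simpa using hd

theorem algInt_neg : (Kdiagram j).algInt < 0 := by
  have hle : (Kdiagram j).algInt ≤ ∑ k ∈ Finset.range (4 * j + 7),
      (if (k % 4 = 1 ∨ k % 4 = 2) ∧ k ≠ 4 * j + 6 then (1 : ℤ) else -1) := by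
    rw [StdDiagram.algInt, show (Kdiagram j).p = 4 * j + 7 from Nat.add_comm _ _]
    refine Finset.sum_le_sum fun k hk => ?_
    rw [Finset.mem_range] at hk
    by_cases h : (Kdiagram j).UpAt k
    · have := upAt_imp (by omega) (by omega) h
      rw [if_pos h, if_pos (by omega)]
    · rw [if_neg h]; split_ifs <;> norm_num
  have hsum : ∀ i : ℕ, ∑ k ∈ Finset.range (4 * i),
      (if (k % 4 = 1 ∨ k % 4 = 2) then (1 : ℤ) else -1) = 0 := by
    intro i
    induction i with
    | zero => simp
    | succ i ih =>
      rw [show 4 * (i + 1) = 4 * i + 1 + 1 + 1 + 1 by ring]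
      simp only [Finset.sum_range_succ, ih]
      simp [Nat.add_mod]
  have heq : ∑ k ∈ Finset.range (4 * j + 7),
      (if (k % 4 = 1 ∨ k % 4 = 2) ∧ k ≠ 4 * j + 6 then (1 : ℤ) else -1) = -1 := by
    rw [Finset.sum_range_succ, if_neg (by simp),
      Finset.sum_congr rfl (g := fun k => if (k % 4 = 1 ∨ k % 4 = 2) then (1 : ℤ) else -1)]
    · rw [show 4 * j + 6 = 4 * (j + 1) + 1 + 1 by ring]
      simp only [Finset.sum_range_succ, hsum]
      simp [Nat.add_mod]
    · intro k hk
      rw [Finset.mem_range] at hk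
      simp [hk.ne]
  omega

/-- The traversal of `β` passes through a state with the given residue data. -/
def Visits (j : ℕ) (top up : Bool) (m : ℤ) : Prop :=
  ∃ n : ℕ, HasResidue j (((Kdiagram j).step)^[n] StdDiagram.start0) top up m

theorem Visits.step {top up top' up' : Bool} {m' : ℤ} (h : Visits j top up m)
    (hs : ∀ σ, HasResidue j σ top up m → HasResidue j ((Kdiagram j).step σ) top' up' m') :
    Visits j top' up' m' := by
  obtain ⟨n, hn⟩ := h
  exact ⟨n + 1, by rw [Function.iterate_succ_apply']; exact hs _ hn⟩

theorem Visits.down_add_four (h : Visits j true false m) (hm : m < 4 * j) (h0 : 0 ≤ m) :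
    Visits j true false (m + 4) := by
  have := (h.step fun _ hσ => hσ.step_top_down_strand hm).step fun _ hσ =>
    hσ.step_bot_down (by omega)
  rwa [show m + 6 - 2 = m + 4 by ring] at this

theorem Visits.down_add_mul_four (h : Visits j true false m) (h0 : 0 ≤ m) {i : ℕ}
    (hm : m + 4 * i < 4 * j + 4) : Visits j true false (m + 4 * i) := by
  induction i with
  | zero => simpa using h
  | succ i ih =>
    push_cast at hm ⊢
    have := (ih (by omega)).down_add_four (by omega) (by omega)
    rwa [show m + 4 * (i + 1 : ℤ) = m + 4 * i + 4 by ring]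

theorem Visits.up_sub_four (h : Visits j true true m) (h0 : 4 ≤ m) (hm : m ≤ 4 * j + 3) :
    Visits j true true (m - 4) := by
  have := (h.step fun _ hσ => hσ.step_top_up (by omega)).step fun _ hσ =>
    hσ.step_bot_up_strand (by omega) (by omega)
  rwa [show m + 2 - 6 = m - 4 by ring] at this

theorem Visits.up_sub_mul_four (h : Visits j true true m) (hm : m ≤ 4 * j + 3) {i : ℕ}
    (h0 : 4 * i ≤ m) : Visits j true true (m - 4 * i) := by
  induction i with
  | zero => simpa using h
  | succ i ih =>
    push_cast at h0 ⊢
    have := (ih (by omega)).up_sub_four (by omega) (by omega)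
    rwa [show m - 4 * (i + 1 : ℤ) = m - 4 * i - 4 by ring]

theorem visits_up_add_five : Visits j true true (4 * j + 5) := by
  have h0 : Visits j true false 0 := ⟨0, hasResidue_start0⟩
  have h := (h0.down_add_mul_four (i := j) le_rfl (by omega)).step fun _ hσ =>
    hσ.step_top_down_rainbow (by omega) (by omega)
  rwa [show 8 * (j : ℤ) + 5 - (0 + 4 * j) = 4 * j + 5 by ring] at h

theorem visits_up_add_two : Visits j true true (4 * j + 2) := by
  have h := ((visits_up_add_five (j := j) |>.step fun _ hσ => hσ.step_top_up_wrap le_rfl).step fun _ hσ =>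
    hσ.step_bot_up_rainbow (by omega)).step fun _ hσ => hσ.step_bot_down (by omega)
  rw [show 5 - (4 * (j : ℤ) + 5 - (4 * j + 5)) - 2 = 3 by ring] at h
  have h' := (h.down_add_mul_four (i := j) (by omega) (by omega)).step fun _ hσ =>
    hσ.step_top_down_rainbow (by omega) (by omega)
  rwa [show 8 * (j : ℤ) + 5 - (3 + 4 * j) = 4 * j + 2 by ring] at h'

theorem visits_up_add_one : Visits j true true (4 * j + 1) := by
  have h := visits_up_add_two.up_sub_mul_four (j := j) (i := j) (by omega) (by omega)
  rw [show 4 * (j : ℤ) + 2 - 4 * j = 2 by ring] at h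
  have h' := (((((h.step fun _ hσ => hσ.step_top_up (by omega)).step fun _ hσ =>
    hσ.step_bot_up_rainbow (by omega)).step fun _ hσ =>
    hσ.step_bot_down_wrap (by omega)).step fun _ hσ =>
    hσ.step_top_down_last (by omega)).step fun _ hσ =>
    hσ.step_bot_down (by omega)).step fun _ hσ =>
    hσ.step_top_down_rainbow (by omega) (by omega)
  rwa [show 8 * (j : ℤ) + 5 - (5 - (2 + 2) + (4 * j + 5) - 2) = 4 * j + 1 by ring] at h'

theorem trueUpPt_iff {k : ℤ} : (Kdiagram j).TrueUpPt k ↔ ¬ (Kdiagram j).UpAt k := by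
  simp [StdDiagram.TrueUpPt, algInt_neg.le.not_gt]

theorem Visits.upAt (h : Visits j true true m) {k : ℤ} (hk : k % (Kdiagram j).pz = m) :
    (Kdiagram j).UpAt k := by
  obtain ⟨n, ht, hu, hm⟩ := h
  exact ⟨n, ht, hm.trans hk.symm, hu⟩

theorem not_upAt_four_mul : ¬ (Kdiagram j).UpAt (4 * j) := fun h => by
  have := upAt_imp (by omega) (by omega) h
  omega

theorem upAt_four_mul_add_one : (Kdiagram j).UpAt (4 * j + 1) :=
  visits_up_add_one.upAt (emod_pz (by omega) (by omega))

theorem upAt_four_mul_add_two : (Kdiagram j).UpAt (4 * j + 2) :=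
  visits_up_add_two.upAt (emod_pz (by omega) (by omega))

theorem upAt_neg_two : (Kdiagram j).UpAt (-2) :=
  visits_up_add_five.upAt <|
    emod_eq_of_shift (c := -1) (emod_pz (m := 0) (by omega) (by omega)) (by omega)
      (by rw [pz_eq]; omega) (by rw [pz_eq]; ring)

theorem not_upAt_neg_one : ¬ (Kdiagram j).UpAt (-1) := fun ⟨n, ht, hm, hu⟩ => by
  have h : (-1 : ℤ) % (Kdiagram j).pz = 4 * j + 6 :=
    emod_eq_of_shift (c := -1) (emod_pz (m := 0) (by omega) (by omega)) (by omega)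
      (by rw [pz_eq]; omega) (by rw [pz_eq]; ring)
  have := upAt_imp (j := j) (m := 4 * j + 6) (by omega) (by omega)
    ⟨n, ht, by rw [hm, h, emod_pz (by omega) (by omega)], hu⟩
  omega

theorem not_upAt_zero : ¬ (Kdiagram j).UpAt 0 := fun h => by
  have := upAt_imp (by omega) (by omega) h
  omega

theorem rainbowArcs_eq : (Kdiagram j).rainbowArcs =
    {(true, 4 * j), (true, 4 * j + 1), (true, 4 * j + 2), (false, 0), (false, 1), (false, 2)} := by
  ext ⟨b, i⟩
  cases b <;> simp [StdDiagram.rainbowArcs, Kdiagram] <;> omega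

theorem rOrientRight_true {i : ℕ} :
    (Kdiagram j).rOrientRight (true, i) ↔ (Kdiagram j).UpAt i := by
  simp [StdDiagram.rOrientRight, trueUpPt_iff]

theorem rOrientRight_false {i : ℕ} :
    (Kdiagram j).rOrientRight (false, i) ↔ ¬ (Kdiagram j).UpAt (i - 2) := by
  simp [StdDiagram.rOrientRight, trueUpPt_iff, sz_eq]

theorem rOrientRight_iff {a : Bool × ℕ} (ha : a ∈ (Kdiagram j).rainbowArcs) :
    (Kdiagram j).rOrientRight a ↔ a ≠ (true, 4 * j) ∧ a ≠ (false, 0) := by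
  rw [rainbowArcs_eq] at ha
  simp only [Finset.mem_insert, Finset.mem_singleton] at ha
  rcases ha with rfl | rfl | rfl | rfl | rfl | rfl
  · simp [rOrientRight_true, not_upAt_four_mul]
  · simp [rOrientRight_true, upAt_four_mul_add_one]
  · simp [rOrientRight_true, upAt_four_mul_add_two]
  · simp [rOrientRight_false, upAt_neg_two]
  · simp [rOrientRight_false, not_upAt_neg_one]
  · simp [rOrientRight_false, not_upAt_zero]

theorem famCnt_false_le (f : Bool) : (Kdiagram j).famCnt f false ≤ (Kdiagram j).famCnt f true := by
  have h1 : (Kdiagram j).famCnt f false ≤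
      ({(f, if f then 4 * j else 0)} : Finset (Bool × ℕ)).card := by
    refine Finset.card_le_card fun a ha => ?_
    obtain ⟨hmem, rfl, ho⟩ := Finset.mem_filter.1 ha
    rw [rOrientRight_iff hmem] at ho
    obtain ⟨b, i⟩ := a
    cases b <;> simpa using ho
  have h2 : ({(f, if f then 4 * j + 1 else 1)} : Finset (Bool × ℕ)).card ≤
      (Kdiagram j).famCnt f true := by
    refine Finset.card_le_card fun a ha => ?_
    rw [Finset.mem_singleton] at ha
    have hmem : a ∈ (Kdiagram j).rainbowArcs := by
      rw [rainbowArcs_eq, ha]; cases f <;> simp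
    refine Finset.mem_filter.2 ⟨hmem, by rw [ha], ?_⟩
    rw [rOrientRight_iff hmem, ha]
    cases f <;> simp
  simpa using h1.trans (by simpa using h2)

theorem inconsArc_iff {a : Bool × ℕ} :
    (Kdiagram j).InconsArc false false a ↔ a = (true, 4 * j) ∨ a = (false, 0) := by
  constructor
  · rintro ⟨ha, ho⟩
    rw [rOrientRight_iff ha] at ho
    simp only [ite_self, Bool.false_eq_true, iff_false] at ho
    tauto
  · intro h
    have ha : a ∈ (Kdiagram j).rainbowArcs := by
      rw [rainbowArcs_eq]; rcases h with rfl | rfl <;> simp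
    refine ⟨ha, ?_⟩
    rw [rOrientRight_iff ha]
    simp only [ite_self, Bool.false_eq_true, iff_false]
    tauto

theorem shareEnd : (Kdiagram j).ShareEnd (true, 4 * j) (false, 0) := by
  refine ⟨((-2 : ℤ) : ZMod (Kdiagram j).p), Finset.mem_inter.2 ⟨?_, ?_⟩⟩
  · simp only [StdDiagram.rEnds, if_true, Finset.mem_insert, Finset.mem_singleton]
    right
    rw [ZMod.intCast_eq_intCast_iff_dvd_sub]
    refine ⟨1, ?_⟩
    change _ = (Kdiagram j).pz * 1
    rw [rz_eq, qz_eq, pz_eq]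
    push_cast
    ring
  · simp [StdDiagram.rEnds, sz_eq]

end Kdiagram

/-- Corollary 1.5, diagrammatic content.  For every `j ≥ 0` the
standard (1,1) diagram with four-tuple `(7 + 4j, 3, 4j, 2)` is strongly almost
coherent. -/
theorem Kdiagram_stronglyAlmostCoherent :
    ∀ j : ℕ, (Kdiagram j).StronglyAlmostCoherent := by
  exact fun j => ⟨false, false, Kdiagram.famCnt_false_le true, Kdiagram.famCnt_false_le false,
    (true, 4 * j), (false, 0), by simp, fun _ => Kdiagram.inconsArc_iff,
    Or.inl Kdiagram.shareEnd⟩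

end

end OneOneKnot
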